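/- Let T₁ = (X₁, E₁) and T₂ = (X₂, E₂) be finite trees with leaf sets B₁ and B₂ respectively, with |B₁| = |B₂|, let d₁, d₂ denote their graph distance functions, and let σ : B₁ → B₂ be a bijection such that d₁(p, q) ≥ d₂(σ(p), σ(q)) for all p, q ∈ B₁. If moreover there exist p₀, q₀ ∈ B₁ with d₁(p₀, q₀) > d₂(σ(p₀), σ(q₀)), then |X₁| > |X₂|. -/

import Mathlib

namespace SimpleGraph

variable {V W : Type*} {G : SimpleGraph V} {H : SimpleGraph W}

/-- In a finite connected graph, any two vertices are joined by a walk through all vertices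
which together with a geodesic back has length at most `2 (|V| - 1)`. -/
theorem Connected.exists_walk_forall_mem_support [Fintype V] (hG : G.Connected) (a b : V) :
    ∃ w : G.Walk a b, (∀ x, x ∈ w.support) ∧ w.length + G.dist a b + 2 ≤ 2 * Fintype.card V := by
  classical
  suffices ∀ n (w : G.Walk a b), w.length + G.dist a b + 2 ≤ 2 * w.support.toFinset.card →
      Fintype.card V - w.support.toFinset.card = n →
      ∃ w : G.Walk a b, (∀ x, x ∈ w.support) ∧
        w.length + G.dist a b + 2 ≤ 2 * Fintype.card V by
    obtain ⟨w, hw, hl⟩ := hG.exists_path_of_dist a b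
    refine this _ w ?_ rfl
    rw [List.toFinset_card_of_nodup hw.support_nodup, Walk.length_support]
    lia
  intro n
  induction n using Nat.strong_induction_on with
  | _ n ih =>
    intro w hw hn
    by_cases hall : ∀ x, x ∈ w.support
    · exact ⟨w, hall, hw.trans (Nat.mul_le_mul_left 2 (Finset.card_le_univ _))⟩
    push Not at hall
    obtain ⟨z, hz⟩ := hall
    obtain ⟨p⟩ := hG.preconnected a z
    obtain ⟨d, -, hx, hy⟩ := p.exists_boundary_dart {x | x ∈ w.support} w.start_mem_support hz
    rw [Set.mem_ofPred_eq] at hx hy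
    let w' : G.Walk a b :=
      (w.takeUntil _ hx).append (.cons d.adj (.cons d.adj.symm (w.dropUntil _ hx)))
    have hlen : w'.length = w.length + 2 := by
      have := congrArg Walk.length (w.take_spec hx)
      simp only [Walk.length_append] at this
      simp only [w', Walk.length_append, Walk.length_cons]
      lia
    have hsub : insert d.snd w.support.toFinset ⊆ w'.support.toFinset := by
      intro x hxm
      rw [Finset.mem_insert, List.mem_toFinset] at hxm
      rw [List.mem_toFinset, Walk.mem_support_append_iff, Walk.support_cons, Walk.support_cons]
      obtain rfl | hxm := hxm
      · simp
      · rw [← w.take_spec hx, Walk.mem_support_append_iff] at hxm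
        simp only [List.mem_cons]
        tauto
    have hcard := Finset.card_le_card hsub
    rw [Finset.card_insert_of_notMem (by simpa using hy)] at hcard
    have := Finset.card_le_univ w'.support.toFinset
    exact ih _ (by lia) w' (by lia) rfl

/-- Removing an edge of a finite acyclic graph leaves a leaf on each side of it. -/
theorem IsAcyclic.exists_degree_eq_one_reachable_deleteEdges [Fintype V] [DecidableRel G.Adj]
    (hG : G.IsAcyclic) {a b : V} (hab : G.Adj a b) :
    ∃ x, G.degree x = 1 ∧ (G.deleteEdges {s(a, b)}).Reachable a x := by
  classical
  let P : ℕ → Prop := fun n ↦ ∃ x, ∃ p : G.Walk x a, p.IsPath ∧ b ∉ p.support ∧ p.length = n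
  have hP : ∃ n, P n ∧ ∀ m, P m → m ≤ n := by
    have h0 : P 0 := ⟨a, .nil, by simp, by simpa using hab.ne', rfl⟩
    have hbound : ∀ n, P n → n ≤ Fintype.card V := by
      rintro n ⟨x, p, hp, -, rfl⟩
      exact hp.length_lt.le
    exact ⟨_, Nat.findGreatest_spec (Nat.zero_le (Fintype.card V)) h0,
      fun m hm ↦ Nat.le_findGreatest (hbound m hm) hm⟩
  obtain ⟨n, ⟨x, p, hp, hb, rfl⟩, hmax⟩ := hP
  refine ⟨x, ?_, ?_⟩
  · by_contra hdeg
    have hp' : (p.concat hab).IsPath := hp.concat hb hab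
    have hsnd : G.Adj x (p.concat hab).snd := Walk.adj_snd (by simp [← Walk.length_eq_zero_iff])
    have hpos : 0 < (G.neighborFinset x).card :=
      Finset.card_pos.mpr ⟨_, (G.mem_neighborFinset _ _).mpr hsnd⟩
    rw [← G.card_neighborFinset_eq_degree] at hdeg
    obtain ⟨y, hy, hne⟩ := Finset.exists_mem_ne (show 1 < (G.neighborFinset x).card by lia)
      (p.concat hab).snd
    rw [mem_neighborFinset] at hy
    have hys : y ∉ (p.concat hab).support := fun h ↦ hne (hG.eq_snd_of_adj_start hp' hy h)
    rw [Walk.support_concat, List.mem_append, not_or] at hys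
    have := hmax _ ⟨y, .cons hy.symm p, hp.cons hys.1, by
      simpa [hb, eq_comm] using hys.2, rfl⟩
    simp at this
  · rw [reachable_deleteEdges_iff_exists_walk]
    refine ⟨p.reverse, fun h ↦ hb ?_⟩
    simpa using p.reverse.snd_mem_support_of_mem_edges h

/-- A closed walk through all leaves of a finite tree traverses every dart. -/
theorem IsAcyclic.mem_darts_of_forall_leaf_mem_support [Fintype V] [DecidableRel G.Adj]
    (hG : G.IsAcyclic) {r : V} (c : G.Walk r r) (hc : ∀ x, G.degree x = 1 → x ∈ c.support)
    (e : G.Dart) : e ∈ c.darts := by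
  classical
  obtain ⟨⟨a, b⟩, hab⟩ := e
  have hbr : ¬ (G.deleteEdges {s(a, b)}).Reachable a b :=
    isAcyclic_iff_forall_adj_isBridge.mp hG hab
  let S : Set V := {x | (G.deleteEdges {s(a, b)}).Reachable a x}
  obtain ⟨x, hx, hxS⟩ := hG.exists_degree_eq_one_reachable_deleteEdges hab
  obtain ⟨y, hy, hyS⟩ := hG.exists_degree_eq_one_reachable_deleteEdges hab.symm
  rw [Sym2.eq_swap] at hyS
  have hyS' : y ∉ S := fun h ↦ hbr (h.trans hyS.symm)
  obtain ⟨d, hd, hd1, hd2⟩ : ∃ d ∈ c.darts, d.fst ∈ S ∧ d.snd ∉ S := by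
    by_cases hr : r ∈ S
    · obtain ⟨d, hd, h⟩ := (c.takeUntil y (hc y hy)).exists_boundary_dart S hr hyS'
      exact ⟨d, c.darts_takeUntil_subset_darts _ hd, h⟩
    · obtain ⟨d, hd, h⟩ := (c.dropUntil x (hc x hx)).exists_boundary_dart S hxS hr
      exact ⟨d, c.darts_dropUntil_subset_darts _ hd, h⟩
  obtain ⟨⟨u, v⟩, huv⟩ := d
  simp only at hd1 hd2
  have heq : s(u, v) = s(a, b) := by
    by_contra hne
    refine hd2 (Reachable.trans hd1 (Adj.reachable ?_))
    rw [deleteEdges_adj]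
    exact ⟨huv, hne⟩
  rw [Sym2.eq_iff] at heq
  obtain ⟨rfl, rfl⟩ | ⟨rfl, rfl⟩ := heq
  · exact hd
  · exact absurd hd1 hbr

theorem IsTree.two_mul_card_le_length_add_two [Fintype V] [DecidableRel G.Adj] (hG : G.IsTree)
    {r : V} (c : G.Walk r r) (hc : ∀ x, G.degree x = 1 → x ∈ c.support) :
    2 * Fintype.card V ≤ c.length + 2 := by
  classical
  have hcard : Fintype.card G.Dart ≤ c.length := by
    rw [← c.length_darts, ← Finset.card_univ]
    refine (Finset.card_le_card fun e _ ↦ ?_).trans c.darts.toFinset_card_le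
    exact List.mem_toFinset.mpr (hG.isAcyclic.mem_darts_of_forall_leaf_mem_support c hc e)
  rw [G.dart_card_eq_twice_card_edges] at hcard
  have := hG.card_edgeFinset
  lia

/-- If `f` does not increase distances on a vertex set `s`, then a walk ending in `s` can be
transported along `f` so that the image visits `f x` for every visited `x` in `s`. -/
theorem Walk.exists_map_walk_of_dist_le (hG : G.Connected) (hH : H.Connected) {s : Set V} (f : s → W)
    (hf : ∀ p q : s, H.dist (f p) (f q) ≤ G.dist p q) {u v : V} (w : G.Walk u v) (hv : v ∈ s) :
    ∀ t : s, ∃ w' : H.Walk (f t) (f ⟨v, hv⟩), w'.length ≤ G.dist t u + w.length ∧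
      ∀ x : s, (x : V) ∈ w.support → f x ∈ w'.support := by
  induction w with
  | nil =>
    intro t
    obtain ⟨g, hg⟩ := hH.exists_walk_length_eq_dist (f t) (f ⟨_, hv⟩)
    refine ⟨g, by simpa [hg] using hf t ⟨_, hv⟩, fun x hx ↦ ?_⟩
    obtain rfl : x = ⟨_, hv⟩ := Subtype.ext (by simpa using hx)
    exact g.end_mem_support
  | @cons u m v h w ih =>
    intro t
    by_cases hu : u ∈ s
    · obtain ⟨g, hg⟩ := hH.exists_walk_length_eq_dist (f t) (f ⟨u, hu⟩)
      obtain ⟨w', hw', hsupp⟩ := ih hv ⟨u, hu⟩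
      refine ⟨g.append w', ?_, fun x hx ↦ ?_⟩
      · have h1 := hf t ⟨u, hu⟩
        have h2 : G.dist u m = 1 := dist_eq_one_iff_adj.mpr h
        simp only [Walk.length_append, Walk.length_cons] at *
        lia
      · rw [Walk.mem_support_append_iff]
        rw [Walk.support_cons, List.mem_cons] at hx
        obtain hx | hx := hx
        · obtain rfl : x = ⟨u, hu⟩ := Subtype.ext hx
          exact .inl g.end_mem_support
        · exact .inr (hsupp x hx)
    · obtain ⟨w', hw', hsupp⟩ := ih hv t
      refine ⟨w', ?_, fun x hx ↦ hsupp x ?_⟩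
      · have h2 : G.dist t m ≤ G.dist t u + 1 :=
          hG.dist_triangle.trans_eq (congrArg _ (dist_eq_one_iff_adj.mpr h))
        simp only [Walk.length_cons]
        lia
      · rw [Walk.support_cons, List.mem_cons] at hx
        exact hx.resolve_left fun hxu ↦ hu (hxu ▸ x.2)

end SimpleGraph

/-- Let `T₁`, `T₂` be finite trees with leaf sets `B₁`, `B₂` of equal cardinality, and let
`σ : B₁ → B₂` be a bijection with `d₁(p,q) ≥ d₂(σ p, σ q)` for all leaves. If moreover
there exist leaves `p₀, q₀` with `d₁(p₀,q₀) > d₂(σ p₀, σ q₀)`, then `|X₁| > |X₂|`. -/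
theorem tree_leaf_distance_strict_monotone_card
    {X₁ X₂ : Type*} [Fintype X₁] [Fintype X₂]
    (T₁ : SimpleGraph X₁) [DecidableRel T₁.Adj] (hT₁ : T₁.IsTree)
    (T₂ : SimpleGraph X₂) [DecidableRel T₂.Adj] (hT₂ : T₂.IsTree)
    (σ : {v : X₁ // T₁.degree v = 1} ≃ {v : X₂ // T₂.degree v = 1})
    (hd : ∀ p q : {v : X₁ // T₁.degree v = 1},
      T₂.dist (σ p : X₂) (σ q : X₂) ≤ T₁.dist (p : X₁) (q : X₁))
    (hstrict : ∃ p₀ q₀ : {v : X₁ // T₁.degree v = 1},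
      T₂.dist (σ p₀ : X₂) (σ q₀ : X₂) < T₁.dist (p₀ : X₁) (q₀ : X₁)) :
    Fintype.card X₂ < Fintype.card X₁ := by
  obtain ⟨p₀, q₀, hlt⟩ := hstrict
  obtain ⟨w, hw, hlen⟩ := hT₁.connected.exists_walk_forall_mem_support (p₀ : X₁) (q₀ : X₁)
  obtain ⟨w', hw', hsupp⟩ := w.exists_map_walk_of_dist_le hT₁.connected hT₂.connected
    (s := {v | T₁.degree v = 1}) (fun v ↦ (σ v : X₂)) hd q₀.2 p₀
  obtain ⟨g, hg⟩ := hT₂.connected.exists_walk_length_eq_dist (σ q₀ : X₂) (σ p₀ : X₂)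
  have hcard := hT₂.two_mul_card_le_length_add_two (w'.append g) fun x hx ↦ by
    obtain ⟨y, hy⟩ := σ.surjective ⟨x, hx⟩
    rw [SimpleGraph.Walk.mem_support_append_iff]
    have := hsupp y (hw y)
    rw [hy] at this
    exact .inl this
  rw [SimpleGraph.Walk.length_append, hg, SimpleGraph.dist_comm] at hcard
  rw [SimpleGraph.dist_self] at hw'
  lia
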